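/- Let f : ℝ → ℝ be a smooth (C^∞) function whose support is a compact subset of (1, ∞). Define h : ℝ → ℝ by h(x) = f(γ(x)) for x ≠ 0 and h(0) = 0. Then h is smooth on ℝ and its support is a compact subset of (0, ∞). (This is the statement that the substitution operator Γ(f) = f ∘ γ maps smooth functions compactly supported in a half-line into smooth functions compactly supported in a half-line.) -/

import Mathlib

/-- The map `γ(x) = x/2 + sign(x)·√(1 + x²/4)` for `x ≠ 0`. -/
noncomputable def gam (x : ℝ) : ℝ := x / 2 + Real.sign x * Real.sqrt (1 + x ^ 2 / 4)

/-- The smooth extension to `ℝ` of the branch of `gam` on `(0, ∞)`. -/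
noncomputable def gamPos (x : ℝ) : ℝ := x / 2 + Real.sqrt (1 + x ^ 2 / 4)

lemma gamPos_mul_self_sub (x : ℝ) : gamPos x * (gamPos x - x) = 1 := by
  have hs : Real.sqrt (1 + x ^ 2 / 4) ^ 2 = 1 + x ^ 2 / 4 := Real.sq_sqrt (by positivity)
  unfold gamPos
  linear_combination hs

lemma gamPos_pos (x : ℝ) : 0 < gamPos x := by
  have hs : |x / 2| < Real.sqrt (1 + x ^ 2 / 4) := by
    rw [← Real.sqrt_sq_eq_abs]
    exact Real.sqrt_lt_sqrt (by positivity) (by linarith [div_pow x 2 2])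
  have := neg_abs_le (x / 2)
  unfold gamPos
  linarith

lemma gamPos_sub_inv (x : ℝ) : gamPos x - (gamPos x)⁻¹ = x := by
  rw [← eq_inv_of_mul_eq_one_right (gamPos_mul_self_sub x)]
  ring

lemma gamPos_le_one {x : ℝ} (hx : x ≤ 0) : gamPos x ≤ 1 := by
  nlinarith [gamPos_mul_self_sub x, gamPos_pos x]

lemma contDiff_gamPos {n : WithTop ℕ∞} : ContDiff ℝ n gamPos := by
  unfold gamPos
  refine (contDiff_id.div_const 2).add (ContDiff.sqrt (by fun_prop) fun x => ?_)
  positivity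

lemma gam_of_pos {x : ℝ} (hx : 0 < x) : gam x = gamPos x := by
  simp [gam, gamPos, Real.sign_of_pos hx]

lemma gam_le_one_of_neg {x : ℝ} (hx : x < 0) : gam x ≤ 1 := by
  have := Real.sqrt_nonneg (1 + x ^ 2 / 4)
  rw [gam, Real.sign_of_neg hx]
  linarith

/-- If `f` is smooth with compact support contained in `(1,∞)`, then the
function `h` with `h x = f (γ x)` for `x ≠ 0` and `h 0 = 0` is smooth with compact
support contained in `(0,∞)`. -/
theorem substitution_preserves_smooth_compactly_supported (f : ℝ → ℝ)
    (hf : ContDiff ℝ (⊤ : ℕ∞) f) (hfc : IsCompact (tsupport f)) (hfs : tsupport f ⊆ Set.Ioi 1)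
    (h : ℝ → ℝ) (hh : ∀ x : ℝ, h x = if x = 0 then 0 else f (gam x)) :
    ContDiff ℝ (⊤ : ℕ∞) h ∧ IsCompact (tsupport h) ∧ tsupport h ⊆ Set.Ioi 0 := by
  have hf0 : ∀ y ≤ 1, f y = 0 := fun y hy =>
    image_eq_zero_of_notMem_tsupport fun hmem => (hfs hmem).not_ge hy
  have heq : h = f ∘ gamPos := by
    funext x
    rw [hh, Function.comp_apply]
    rcases lt_trichotomy x 0 with hx | rfl | hx
    · rw [if_neg hx.ne, hf0 _ (gam_le_one_of_neg hx), hf0 _ (gamPos_le_one hx.le)]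
    · rw [if_pos rfl, hf0 _ (gamPos_le_one le_rfl)]
    · rw [if_neg hx.ne', gam_of_pos hx]
  have hK : IsCompact ((fun y : ℝ => y - y⁻¹) '' tsupport f) := by
    refine hfc.image_of_continuousOn (continuousOn_id.sub (continuousOn_id.inv₀ fun y hy => ?_))
    exact (zero_lt_one.trans (hfs hy)).ne'
  have hsub : tsupport h ⊆ (fun y : ℝ => y - y⁻¹) '' tsupport f := by
    refine closure_minimal (fun x hx => ?_) hK.isClosed
    rw [heq] at hx
    exact ⟨gamPos x, subset_tsupport f hx, gamPos_sub_inv x⟩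
  refine ⟨heq ▸ hf.comp contDiff_gamPos, hK.of_isClosed_subset (isClosed_tsupport h) hsub, ?_⟩
  refine hsub.trans ?_
  rintro _ ⟨y, hy, rfl⟩
  have hy1 : 1 < y := hfs hy
  exact sub_pos.2 ((inv_lt_one_of_one_lt₀ hy1).trans hy1)
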